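/- The Hausdorff dimension of the attractor Λ_{β,τ} equals 1 + log β / log(τ^{-1}); in particular it lies strictly between 1 and 2 for all β ∈ (1,2) and τ ∈ (0,1/2). -/

import Mathlib

open Set MeasureTheory

/-- The skew map `f` on `[0,1]²`. -/
noncomputable def skewMap (β τ : ℝ) (p : ℝ × ℝ) : ℝ × ℝ :=
  if p.1 ≤ β⁻¹ then (β * p.1, τ * p.2) else (β * p.1 - 1, τ * p.2 + (1 - τ))

/-- The attractor `Λ_{β,τ} = closure(⋂_{i≥0} f^i([0,1]²))`. -/
noncomputable def attractor (β τ : ℝ) : Set (ℝ × ℝ) :=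
  closure (⋂ i : ℕ, (skewMap β τ)^[i] '' (Icc (0:ℝ) 1 ×ˢ Icc (0:ℝ) 1))

open Filter Topology Metric
open scoped ENNReal NNReal

/-- The axis-parallel closed square of side `δ` with lower left corner `p`. -/
def cornerSquare (δ : ℝ) (p : ℝ × ℝ) : Set (ℝ × ℝ) :=
  Icc p.1 (p.1 + δ) ×ˢ Icc p.2 (p.2 + δ)

theorem ediam_cornerSquare_le {δ : ℝ} (p : ℝ × ℝ) :
    ediam (cornerSquare δ p) ≤ ENNReal.ofReal δ := by
  refine ediam_le_of_forall_dist_le fun x hx y hy => ?_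
  obtain ⟨⟨_, _⟩, _, _⟩ := hx
  obtain ⟨⟨_, _⟩, _, _⟩ := hy
  rw [Prod.dist_eq, Real.dist_eq, Real.dist_eq]
  refine max_le (abs_le.2 ⟨?_, ?_⟩) (abs_le.2 ⟨?_, ?_⟩) <;> linarith

theorem exists_cornerSquare_cover_rectangle {a b c h : ℝ} (hab : a ≤ b) (hh : 0 < h) :
    ∃ L : Finset (ℝ × ℝ), (L.card : ℝ) ≤ (b - a) / h + 1 ∧
      Icc a b ×ˢ Icc c (c + h) ⊆ ⋃ p ∈ L, cornerSquare h p := by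
  have hq : 0 ≤ (b - a) / h := div_nonneg (sub_nonneg.2 hab) hh.le
  refine ⟨(Finset.range (⌊(b - a) / h⌋₊ + 1)).image fun i : ℕ => (a + i * h, c), ?_, ?_⟩
  · refine (Nat.cast_le.2 Finset.card_image_le).trans ?_
    rw [Finset.card_range, Nat.cast_add, Nat.cast_one]
    linarith [Nat.floor_le hq]
  · rintro ⟨x, y⟩ ⟨⟨hxa, hxb⟩, hy⟩
    have hx : 0 ≤ (x - a) / h := div_nonneg (sub_nonneg.2 hxa) hh.le
    refine mem_iUnion₂.2 ⟨(a + ⌊(x - a) / h⌋₊ * h, c), ?_, ⟨?_, ?_⟩, hy⟩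
    · refine Finset.mem_image.2 ⟨_, ?_, rfl⟩
      rw [Finset.mem_range, Nat.lt_succ_iff]
      dsimp only at hxb
      gcongr
    · have := (le_div_iff₀ hh).1 (Nat.floor_le hx)
      dsimp only
      linarith
    · have := (div_lt_iff₀ hh).1 (Nat.lt_floor_add_one ((x - a) / h))
      dsimp only
      linarith

section UpperBound

variable {β τ : ℝ}

theorem skewMap_image_left_subset (hβ : 0 < β) (hτ : 0 < τ) {a b c h : ℝ} (hb : b ≤ β⁻¹) :
    skewMap β τ '' (Icc a b ×ˢ Icc c (c + h)) ⊆
      Icc (β * a) (β * b) ×ˢ Icc (τ * c) (τ * c + τ * h) := by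
  rintro _ ⟨⟨x, y⟩, ⟨⟨hxa, hxb⟩, hyc, hyh⟩, rfl⟩
  dsimp only at hxa hxb hyc hyh
  rw [skewMap, if_pos (hxb.trans hb)]
  refine ⟨⟨?_, ?_⟩, ?_, ?_⟩ <;> dsimp only <;> nlinarith

theorem skewMap_image_right_subset (hβ : 0 < β) (hτ : 0 < τ) {a b c h : ℝ} :
    skewMap β τ '' ((Icc a b ∩ Ioi β⁻¹) ×ˢ Icc c (c + h)) ⊆
      Icc (β * a - 1) (β * b - 1) ×ˢ
        Icc (τ * c + (1 - τ)) (τ * c + (1 - τ) + τ * h) := by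
  rintro _ ⟨⟨x, y⟩, ⟨⟨⟨hxa, hxb⟩, hx⟩, hyc, hyh⟩, rfl⟩
  dsimp only at hxa hxb hyc hyh
  rw [skewMap, if_neg (not_le.2 hx)]
  refine ⟨⟨?_, ?_⟩, ?_, ?_⟩ <;> dsimp only <;> nlinarith

theorem exists_cornerSquare_cover_iterate (hβ : 0 < β) (hτ : 0 < τ) (n : ℕ) {a b c h : ℝ}
    (hab : a ≤ b) (hh : 0 < h) :
    ∃ L : Finset (ℝ × ℝ), (L.card : ℝ) ≤ (b - a) * β ^ n / (τ ^ n * h) + 2 ^ n ∧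
      (skewMap β τ)^[n] '' (Icc a b ×ˢ Icc c (c + h)) ⊆ ⋃ p ∈ L, cornerSquare (τ ^ n * h) p := by
  induction n generalizing a b c h with
  | zero => simpa using exists_cornerSquare_cover_rectangle hab hh
  | succ n ih =>
    have hstep : ∀ l : ℝ, β * l * β ^ n / (τ ^ n * (τ * h)) =
        l * β ^ (n + 1) / (τ ^ (n + 1) * h) := fun l => by
      rw [pow_succ, pow_succ]; congr 1 <;> ring
    have hside : τ ^ n * (τ * h) = τ ^ (n + 1) * h := by ring
    have htwo : (2 : ℝ) ^ n ≤ 2 ^ (n + 1) := pow_le_pow_right₀ one_le_two n.le_succ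
    have hleft : ∀ b' ≤ β⁻¹, a ≤ b' → ∃ L : Finset (ℝ × ℝ),
        (L.card : ℝ) ≤ (b' - a) * β ^ (n + 1) / (τ ^ (n + 1) * h) + 2 ^ n ∧
        (skewMap β τ)^[n] '' (skewMap β τ '' (Icc a b' ×ˢ Icc c (c + h))) ⊆
          ⋃ p ∈ L, cornerSquare (τ ^ (n + 1) * h) p := fun b' hb' hab' => by
      obtain ⟨L, hL, hcov⟩ := @ih (β * a) (β * b') (τ * c) (τ * h)
        (mul_le_mul_of_nonneg_left hab' hβ.le) (mul_pos hτ hh)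
      rw [← mul_sub, hstep] at hL
      rw [hside] at hcov
      exact ⟨L, hL, (image_mono (skewMap_image_left_subset hβ hτ hb')).trans hcov⟩
    have hright : ∀ a', a' ≤ b → ∃ L : Finset (ℝ × ℝ),
        (L.card : ℝ) ≤ (b - a') * β ^ (n + 1) / (τ ^ (n + 1) * h) + 2 ^ n ∧
        (skewMap β τ)^[n] '' (skewMap β τ '' ((Icc a' b ∩ Ioi β⁻¹) ×ˢ Icc c (c + h))) ⊆
          ⋃ p ∈ L, cornerSquare (τ ^ (n + 1) * h) p := fun a' hab' => by
      obtain ⟨L, hL, hcov⟩ := @ih (β * a' - 1) (β * b - 1) (τ * c + (1 - τ)) (τ * h)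
        (sub_le_sub_right (mul_le_mul_of_nonneg_left hab' hβ.le) 1) (mul_pos hτ hh)
      rw [sub_sub_sub_cancel_right, ← mul_sub, hstep] at hL
      rw [hside] at hcov
      exact ⟨L, hL, (image_mono (skewMap_image_right_subset hβ hτ)).trans hcov⟩
    rw [Function.iterate_succ, image_comp]
    rcases le_or_gt b β⁻¹ with hb | hb
    · obtain ⟨L, hL, hcov⟩ := hleft b hb hab
      exact ⟨L, by linarith, hcov⟩
    rcases lt_or_ge β⁻¹ a with ha | ha
    · obtain ⟨L, hL, hcov⟩ := hright a hab
      refine ⟨L, by linarith, ?_⟩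
      have hsub : Icc a b ⊆ Ioi β⁻¹ := fun x hx => ha.trans_le hx.1
      rwa [inter_eq_left.2 hsub] at hcov
    · obtain ⟨L₀, hL₀, hcov₀⟩ := hleft β⁻¹ le_rfl ha
      obtain ⟨L₁, hL₁, hcov₁⟩ := hright β⁻¹ hb.le
      refine ⟨L₀ ∪ L₁, ?_, ?_⟩
      · calc ((L₀ ∪ L₁).card : ℝ) ≤ L₀.card + L₁.card := mod_cast Finset.card_union_le _ _
          _ ≤ _ := add_le_add hL₀ hL₁
          _ = _ := by ring
      · rw [Finset.set_biUnion_union]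
        refine Subset.trans ?_ (union_subset_union hcov₀ hcov₁)
        rw [← image_union, ← image_union]
        refine image_mono (image_mono ?_)
        rintro ⟨x, y⟩ ⟨hx, hy⟩
        rcases le_or_gt x β⁻¹ with h | h
        · exact Or.inl ⟨⟨hx.1, h⟩, hy⟩
        · exact Or.inr ⟨⟨⟨h.le, hx.2⟩, h⟩, hy⟩

theorem hausdorffMeasure_attractor_le {s : ℝ} (hβ : 1 < β) (hτ0 : 0 < τ) (hτ : τ < 1 / 2)
    (hs0 : 0 ≤ s) (hs : τ ^ s = τ / β) : μH[s] (attractor β τ) ≤ 2 := by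
  have hβ0 : 0 < β := one_pos.trans hβ
  choose L hL hcov using fun n : ℕ =>
    exists_cornerSquare_cover_iterate (c := 0) hβ0 hτ0 n zero_le_one one_pos
  simp only [sub_zero, one_mul, mul_one, zero_add] at hL hcov
  have hle : ∀ n, ∑ i : L n, ediam (cornerSquare (τ ^ n) i) ^ s ≤ 2 := fun n => by
    calc ∑ i : L n, ediam (cornerSquare (τ ^ n) i) ^ s
        ≤ ∑ _i : L n, ENNReal.ofReal ((τ / β) ^ n) := Finset.sum_le_sum fun i _ => by
          refine (ENNReal.rpow_le_rpow (ediam_cornerSquare_le _) hs0).trans_eq ?_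
          rw [ENNReal.ofReal_rpow_of_pos (pow_pos hτ0 n), ← Real.rpow_natCast_mul hτ0.le,
            mul_comm, Real.rpow_mul_natCast hτ0.le, hs]
      _ = ENNReal.ofReal ((L n).card * (τ / β) ^ n) := by
          rw [Finset.sum_const, Finset.card_univ, Fintype.card_coe, nsmul_eq_mul,
            ENNReal.ofReal_mul (Nat.cast_nonneg _), ENNReal.ofReal_natCast]
      _ ≤ ENNReal.ofReal 2 := by
          refine ENNReal.ofReal_le_ofReal ?_
          calc ((L n).card : ℝ) * (τ / β) ^ n ≤ (β ^ n / τ ^ n + 2 ^ n) * (τ / β) ^ n :=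
                mul_le_mul_of_nonneg_right (hL n) (by positivity)
            _ = 1 + (2 * τ / β) ^ n := by
                rw [add_mul, ← div_pow, ← mul_pow, ← mul_pow, mul_div_assoc,
                  show β / τ * (τ / β) = 1 by field_simp, one_pow]
            _ ≤ 1 + 1 := by
                gcongr
                exact pow_le_one₀ (by positivity) ((div_le_one hβ0).2 (by linarith))
            _ = 2 := one_add_one_eq_two
      _ = 2 := by simp
  refine (Measure.hausdorffMeasure_le_liminf_sum s _ (l := atTop) (fun n => ENNReal.ofReal (τ ^ n)) ?_
    (fun n (i : L n) => cornerSquare (τ ^ n) i) (.of_forall fun n i => ediam_cornerSquare_le _)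
    (.of_forall fun n => ?_)).trans ?_
  · rw [← ENNReal.ofReal_zero]
    exact ENNReal.tendsto_ofReal (tendsto_pow_atTop_nhds_zero_of_lt_one hτ0.le (by linarith))
  · have hunion : ⋃ i : L n, cornerSquare (τ ^ n) i = ⋃ p ∈ L n, cornerSquare (τ ^ n) p :=
      iUnion_subtype _ _
    rw [hunion]
    refine closure_minimal ((iInter_subset _ n).trans (hcov n)) ?_
    exact (L n).finite_toSet.isClosed_biUnion fun i _ => isClosed_Icc.prod isClosed_Icc
  · exact (liminf_le_liminf (.of_forall hle)).trans_eq (liminf_const 2)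

end UpperBound

section BetaMap

variable {β : ℝ}

/-- The greedy `β`-transformation, in the convention that sends `β⁻¹` to `1`. -/
noncomputable def betaMap (β x : ℝ) : ℝ :=
  if x ≤ β⁻¹ then β * x else β * x - 1

theorem measurable_betaMap : Measurable (betaMap β) :=
  Measurable.ite measurableSet_Iic (by fun_prop) (by fun_prop)

theorem betaMap_mem_Icc (hβ : 1 < β) (hβ2 : β < 2) {x : ℝ} (hx : x ∈ Icc (0 : ℝ) 1) :
    betaMap β x ∈ Icc (0 : ℝ) 1 := by
  have hβ0 : 0 < β := one_pos.trans hβ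
  obtain ⟨h0, h1⟩ := hx
  rw [betaMap]
  split_ifs with h
  · rw [← one_div, le_div_iff₀' hβ0] at h
    exact ⟨by positivity, h⟩
  · rw [← one_div, le_div_iff₀' hβ0, not_le] at h
    constructor <;> nlinarith

theorem betaMap_iterate_mem_Icc (hβ : 1 < β) (hβ2 : β < 2) {x : ℝ} (hx : x ∈ Icc (0 : ℝ) 1)
    (n : ℕ) : (betaMap β)^[n] x ∈ Icc (0 : ℝ) 1 :=
  (show MapsTo (betaMap β) (Icc 0 1) (Icc 0 1) from fun _ => betaMap_mem_Icc hβ hβ2).iterate n hx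

theorem volume_preimage_affine (hβ : 0 < β) (d : ℝ) (A : Set ℝ) :
    volume ((fun x => β * x - d) ⁻¹' A) = ENNReal.ofReal β⁻¹ * volume A := by
  have : (fun x => β * x - d) ⁻¹' A = (fun x => β * x) ⁻¹' ((fun x => x + -d) ⁻¹' A) := rfl
  rw [this, Real.volume_preimage_mul_left hβ.ne', abs_of_pos (inv_pos.2 hβ),
    measure_preimage_add_right]

/-- The first digit of the greedy `β`-expansion of `x`. -/
noncomputable def betaDigit (β x : ℝ) : ℝ≥0 :=
  if x ≤ β⁻¹ then 0 else 1

theorem betaMap_eq (x : ℝ) : betaMap β x = β * x - betaDigit β x := by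
  rw [betaMap, betaDigit]
  split_ifs <;> simp

theorem volume_preimage_betaMap_inter_le (hβ : 0 < β) (A : Set ℝ) (t : ℝ) :
    volume (betaMap β ⁻¹' A ∩ Icc 0 t) ≤ ENNReal.ofReal β⁻¹ *
      (volume (A ∩ Icc 0 (betaMap β t)) + betaDigit β t * volume (A ∩ Icc 0 1)) := by
  rw [betaMap, betaDigit]
  split_ifs with ht
  · rw [ENNReal.coe_zero, zero_mul, add_zero, ← volume_preimage_affine hβ 0]
    refine measure_mono ?_
    rintro x ⟨hx, hx0, hxt⟩
    rw [mem_preimage, betaMap, if_pos (hxt.trans ht)] at hx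
    rw [mem_preimage, sub_zero]
    exact ⟨hx, mul_nonneg hβ.le hx0, by gcongr⟩
  · rw [ENNReal.coe_one, one_mul, mul_add, ← volume_preimage_affine hβ 1,
      ← volume_preimage_affine hβ 0]
    refine (measure_mono ?_).trans (measure_union_le _ _)
    rintro x ⟨hx, hx0, hxt⟩
    rw [mem_preimage, betaMap] at hx
    have hiff : x ≤ β⁻¹ ↔ β * x ≤ 1 := by rw [← one_div, le_div_iff₀' hβ]
    split_ifs at hx with h
    · right
      rw [mem_preimage, sub_zero]
      exact ⟨hx, mul_nonneg hβ.le hx0, hiff.1 h⟩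
    · left
      rw [hiff, not_le] at h
      exact ⟨hx, by linarith, sub_le_sub_right (mul_le_mul_of_nonneg_left hxt hβ.le) 1⟩

/-- Parry's invariant density, as the set function `A ↦ ∑ β⁻ʲ |A ∩ [0, Tʲ 1]|`. -/
noncomputable def parryContent (β : ℝ) (A : Set ℝ) : ℝ≥0∞ :=
  ∑' j : ℕ, ENNReal.ofReal β⁻¹ ^ j * volume (A ∩ Icc 0 ((betaMap β)^[j] 1))

theorem tsum_betaDigit_le_one (hβ : 1 < β) (hβ2 : β < 2) :
    ∑' j : ℕ, ENNReal.ofReal β⁻¹ ^ (j + 1) * betaDigit β ((betaMap β)^[j] 1) ≤ 1 := by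
  have hβ0 : 0 < β := one_pos.trans hβ
  have hsum : ∀ n : ℕ, ∑ j ∈ Finset.range n, β⁻¹ ^ (j + 1) * betaDigit β ((betaMap β)^[j] 1) =
      1 - β⁻¹ ^ n * (betaMap β)^[n] 1 := fun n => by
    induction n with
    | zero => simp
    | succ n ih =>
      rw [Finset.sum_range_succ, ih, Function.iterate_succ_apply', betaMap_eq, pow_succ]
      field_simp
      ring
  refine ENNReal.tsum_le_of_sum_range_le fun n => ?_
  calc ∑ j ∈ Finset.range n, ENNReal.ofReal β⁻¹ ^ (j + 1) * betaDigit β ((betaMap β)^[j] 1)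
      = ENNReal.ofReal (∑ j ∈ Finset.range n,
          β⁻¹ ^ (j + 1) * betaDigit β ((betaMap β)^[j] 1)) := by
        rw [ENNReal.ofReal_sum_of_nonneg fun j _ => by positivity]
        refine Finset.sum_congr rfl fun j _ => ?_
        rw [ENNReal.ofReal_mul (by positivity), ENNReal.ofReal_pow (by positivity),
          ENNReal.ofReal_coe_nnreal]
    _ ≤ ENNReal.ofReal 1 := by
        have := (betaMap_iterate_mem_Icc hβ hβ2 (right_mem_Icc.2 zero_le_one) n).1
        rw [hsum]
        exact ENNReal.ofReal_le_ofReal (sub_le_self _ (by positivity))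
    _ = 1 := ENNReal.ofReal_one

theorem parryContent_preimage_le (hβ : 1 < β) (hβ2 : β < 2) (A : Set ℝ) :
    parryContent β (betaMap β ⁻¹' A) ≤ parryContent β A := by
  set b := ENNReal.ofReal β⁻¹ with hb
  calc parryContent β (betaMap β ⁻¹' A)
      ≤ ∑' j : ℕ, (b ^ (j + 1) * volume (A ∩ Icc 0 ((betaMap β)^[j + 1] 1)) +
          b ^ (j + 1) * betaDigit β ((betaMap β)^[j] 1) * volume (A ∩ Icc 0 1)) := by
        refine ENNReal.tsum_le_tsum fun j => ?_
        refine (mul_le_mul_right (volume_preimage_betaMap_inter_le (one_pos.trans hβ) A _) _).trans_eq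
          ?_
        rw [Function.iterate_succ_apply', pow_succ, ← hb]
        ring
    _ ≤ ∑' j : ℕ, b ^ (j + 1) * volume (A ∩ Icc 0 ((betaMap β)^[j + 1] 1)) +
          1 * volume (A ∩ Icc 0 1) := by
        rw [ENNReal.tsum_add, ENNReal.tsum_mul_right]
        gcongr
        exact tsum_betaDigit_le_one hβ hβ2
    _ = parryContent β A := by
        conv_rhs => rw [parryContent, tsum_eq_zero_add' ENNReal.summable, add_comm, pow_zero,
          Function.iterate_zero_apply]

theorem volume_preimage_betaMap_iterate_le (hβ : 1 < β) (hβ2 : β < 2) (A : Set ℝ) (n : ℕ) :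
    volume ((betaMap β)^[n] ⁻¹' A ∩ Icc 0 1) ≤ (1 - ENNReal.ofReal β⁻¹)⁻¹ * volume A := by
  calc volume ((betaMap β)^[n] ⁻¹' A ∩ Icc 0 1) ≤ parryContent β ((betaMap β)^[n] ⁻¹' A) := by
        rw [parryContent]
        refine le_trans ?_ (ENNReal.le_tsum 0)
        simp
    _ ≤ parryContent β A := by
        induction n generalizing A with
        | zero => rfl
        | succ n ih =>
          rw [Function.iterate_succ', preimage_comp]
          exact (ih _).trans (parryContent_preimage_le hβ hβ2 A)
    _ ≤ (1 - ENNReal.ofReal β⁻¹)⁻¹ * volume A := by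
        rw [← ENNReal.tsum_geometric, ← ENNReal.tsum_mul_right]
        exact ENNReal.tsum_le_tsum fun j => by gcongr; exact inter_subset_left

end BetaMap

section LowerBound

variable {β τ : ℝ}

theorem skewMap_fst (p : ℝ × ℝ) : (skewMap β τ p).1 = betaMap β p.1 := by
  rw [skewMap, betaMap]
  split_ifs <;> rfl

theorem skewMap_iterate_fst (n : ℕ) (p : ℝ × ℝ) :
    ((skewMap β τ)^[n] p).1 = (betaMap β)^[n] p.1 :=
  ((show Function.Semiconj Prod.fst (skewMap β τ) (betaMap β) from skewMap_fst).iterate_right n) p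

theorem skewMap_snd_mem_Icc (hτ0 : 0 < τ) (hτ : τ < 1 / 2) {p : ℝ × ℝ}
    (hp : p.2 ∈ Icc (0 : ℝ) 1) : (skewMap β τ p).2 ∈ Icc (0 : ℝ) 1 := by
  obtain ⟨h0, h1⟩ := hp
  rw [skewMap]
  split_ifs <;> constructor <;> dsimp only <;> nlinarith

theorem skewMap_iterate_snd_mem_Icc (hτ0 : 0 < τ) (hτ : τ < 1 / 2) {p : ℝ × ℝ}
    (hp : p.2 ∈ Icc (0 : ℝ) 1) (n : ℕ) : ((skewMap β τ)^[n] p).2 ∈ Icc (0 : ℝ) 1 :=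
  (show MapsTo (skewMap β τ) {p | p.2 ∈ Icc 0 1} {p | p.2 ∈ Icc 0 1} from
    fun _ => skewMap_snd_mem_Icc hτ0 hτ).iterate n hp

theorem skewMap_mapsTo_square (hβ : 1 < β) (hβ2 : β < 2) (hτ0 : 0 < τ) (hτ : τ < 1 / 2) :
    MapsTo (skewMap β τ) (Icc 0 1 ×ˢ Icc 0 1) (Icc 0 1 ×ˢ Icc 0 1) := fun p hp =>
  ⟨skewMap_fst (τ := τ) p ▸ betaMap_mem_Icc hβ hβ2 hp.1, skewMap_snd_mem_Icc hτ0 hτ hp.2⟩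

theorem abs_fst_iterate_sub_of_abs_snd_iterate_sub_le (hβ : 0 < β) (hτ0 : 0 < τ)
    (hτ : τ < 1 / 2) {p q : ℝ × ℝ} (hp : p.2 ∈ Icc (0 : ℝ) 1) (hq : q.2 ∈ Icc (0 : ℝ) 1) {m : ℕ}
    (h : |((skewMap β τ)^[m] p).2 - ((skewMap β τ)^[m] q).2| ≤ τ ^ m * (1 - 2 * τ)) :
    |((skewMap β τ)^[m] p).1 - ((skewMap β τ)^[m] q).1| = β ^ m * |p.1 - q.1| := by
  induction m with
  | zero => simp
  | succ m ih =>
    have hP := skewMap_iterate_snd_mem_Icc (β := β) hτ0 hτ hp m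
    have hQ := skewMap_iterate_snd_mem_Icc (β := β) hτ0 hτ hq m
    rw [Function.iterate_succ_apply', Function.iterate_succ_apply'] at h ⊢
    set P := (skewMap β τ)^[m] p
    set Q := (skewMap β τ)^[m] q
    have hgap : τ ^ (m + 1) * (1 - 2 * τ) < 1 - 2 * τ :=
      mul_lt_of_lt_one_left (by linarith)
        (pow_lt_one₀ hτ0.le (by linarith) m.succ_ne_zero)
    have hcontr : ∀ {u v : ℝ}, u ∈ Icc (0 : ℝ) 1 → v ∈ Icc (0 : ℝ) 1 →
        |τ * u - (τ * v + (1 - τ))| ≤ τ ^ (m + 1) * (1 - 2 * τ) → False := fun hu hv huv => by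
      have := (abs_le.1 huv).1
      nlinarith [hu.2, hv.1]
    have hscale : |τ * P.2 - τ * Q.2| ≤ τ ^ (m + 1) * (1 - 2 * τ) →
        |P.1 - Q.1| = β ^ m * |p.1 - q.1| := fun hPQ => ih <| by
      rw [← mul_sub, abs_mul, abs_of_pos hτ0, pow_succ', mul_assoc] at hPQ
      exact le_of_mul_le_mul_left hPQ hτ0
    have hexp : |β * P.1 - β * Q.1| = β * |P.1 - Q.1| := by
      rw [← mul_sub, abs_mul, abs_of_pos hβ]
    rw [skewMap, skewMap] at h ⊢
    split_ifs at h ⊢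
    · rw [hexp, hscale h, pow_succ', mul_assoc]
    · exact (hcontr hP hQ h).elim
    · rw [abs_sub_comm] at h
      exact (hcontr hQ hP h).elim
    · rw [add_sub_add_right_eq_sub] at h
      rw [sub_sub_sub_cancel_right, hexp, hscale h, pow_succ', mul_assoc]

theorem volume_le_of_dist_skewMap_iterate_le (hβ : 1 < β) (hβ2 : β < 2) (hτ0 : 0 < τ)
    (hτ : τ < 1 / 2) {A : Set ℝ} (hA : A ⊆ Icc 0 1) {r : ℝ} {m n : ℕ} (hmn : m ≤ n)
    (hr : r ≤ τ ^ m * (1 - 2 * τ))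
    (hdist : ∀ x ∈ A, ∀ x' ∈ A, dist ((skewMap β τ)^[n] (x, 0)) ((skewMap β τ)^[n] (x', 0)) ≤ r) :
    volume A ≤ (1 - ENNReal.ofReal β⁻¹)⁻¹ * ENNReal.ofReal (r / β ^ m) := by
  have hβ0 : 0 < β := one_pos.trans hβ
  have hsub : A ⊆ (betaMap β)^[n - m] ⁻¹' ((betaMap β)^[n - m] '' A) ∩ Icc 0 1 :=
    subset_inter (subset_preimage_image _ _) hA
  refine (measure_mono hsub).trans ((volume_preimage_betaMap_iterate_le hβ hβ2 _ _).trans ?_)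
  gcongr
  refine (Real.volume_le_diam _).trans (ediam_le_of_forall_dist_le ?_)
  rintro _ ⟨x, hx, rfl⟩ _ ⟨x', hx', rfl⟩
  have h := hdist x hx x' hx'
  obtain ⟨k, rfl⟩ := Nat.exists_eq_add_of_le hmn
  rw [Function.iterate_add_apply, Function.iterate_add_apply, Prod.dist_eq, Real.dist_eq,
    Real.dist_eq] at h
  have h0 : (0 : ℝ) ∈ Icc (0 : ℝ) 1 := left_mem_Icc.2 zero_le_one
  have hfst := abs_fst_iterate_sub_of_abs_snd_iterate_sub_le hβ0 hτ0 hτ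
    (skewMap_iterate_snd_mem_Icc (β := β) (p := (x, 0)) hτ0 hτ h0 k)
    (skewMap_iterate_snd_mem_Icc (β := β) (p := (x', 0)) hτ0 hτ h0 k)
    (((le_max_right _ _).trans h).trans hr)
  rw [skewMap_iterate_fst k, skewMap_iterate_fst k] at hfst
  rw [Nat.add_sub_cancel_left, Real.dist_eq, le_div_iff₀' (pow_pos hβ0 m), ← hfst]
  exact (le_max_left _ _).trans h

theorem exists_volume_preimage_iterate_le_rpow (hβ : 1 < β) (hβ2 : β < 2) (hτ0 : 0 < τ)
    (hτ : τ < 1 / 2) {σ : ℝ} (hσ0 : 0 < σ) (hσ : τ ^ σ = β⁻¹) :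
    ∃ K : ℝ≥0∞, K ≠ ∞ ∧ ∀ r : ℝ, 0 < r → r ≤ 1 - 2 * τ → ∃ N : ℕ, ∀ n ≥ N, ∀ U : Set (ℝ × ℝ),
      ediam U ≤ ENNReal.ofReal r →
        volume {x ∈ Icc (0 : ℝ) 1 | (skewMap β τ)^[n] (x, 0) ∈ U} ≤
          K * ENNReal.ofReal (r ^ (1 + σ)) := by
  have hβ0 : 0 < β := one_pos.trans hβ
  have hc : 0 < 1 - 2 * τ := by linarith
  refine ⟨(1 - ENNReal.ofReal β⁻¹)⁻¹ * ENNReal.ofReal (β / (1 - 2 * τ) ^ σ), ?_, ?_⟩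
  · refine ENNReal.mul_ne_top ?_ ENNReal.ofReal_ne_top
    rw [ENNReal.inv_ne_top]
    refine (tsub_pos_iff_lt.2 (ENNReal.ofReal_lt_one.2 ?_)).ne'
    exact inv_lt_one_of_one_lt₀ hβ
  · intro r hr0 hr
    obtain ⟨m, hm, hm'⟩ := exists_nat_pow_near_of_lt_one (div_pos hr0 hc) ((div_le_one hc).2 hr)
      hτ0 (by linarith)
    rw [lt_div_iff₀ hc] at hm
    rw [div_le_iff₀ hc] at hm'
    refine ⟨m, fun n hn U hU => ?_⟩
    refine (volume_le_of_dist_skewMap_iterate_le hβ hβ2 hτ0 hτ (fun x hx => hx.1) hn hm'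
      fun x hx x' hx' => ?_).trans ?_
    · have := (edist_le_ediam_of_mem hx.2 hx'.2).trans hU
      rwa [edist_dist, ENNReal.ofReal_le_ofReal_iff hr0.le] at this
    · rw [mul_assoc, ← ENNReal.ofReal_mul (by positivity)]
      gcongr
      have hpow : (1 - 2 * τ) ^ σ * β⁻¹ ^ (m + 1) ≤ r ^ σ := by
        rw [← hσ, ← Real.rpow_mul_natCast hτ0.le, mul_comm σ, Real.rpow_natCast_mul hτ0.le,
          ← Real.mul_rpow hc.le (by positivity), mul_comm]
        exact Real.rpow_le_rpow (by positivity) hm.le hσ0.le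
      rw [Real.rpow_add hr0, Real.rpow_one]
      have hcσ : 0 < (1 - 2 * τ) ^ σ := Real.rpow_pos_of_pos hc σ
      calc r / β ^ m = β / (1 - 2 * τ) ^ σ * (r * ((1 - 2 * τ) ^ σ * β⁻¹ ^ (m + 1))) := by
            rw [inv_pow, pow_succ]
            field_simp
        _ ≤ _ := by gcongr

theorem closure_skewMap_image_subset (hβ : 0 < β) {S : Set (ℝ × ℝ)} (hS : IsCompact (closure S)) :
    closure (skewMap β τ '' S) ⊆ skewMap β τ '' closure S ∪ {p | p.1 = 0} := by
  set g₀ : ℝ × ℝ → ℝ × ℝ := fun p => (β * p.1, τ * p.2)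
  set g₁ : ℝ × ℝ → ℝ × ℝ := fun p => (β * p.1 - 1, τ * p.2 + (1 - τ))
  have himage : skewMap β τ '' S ⊆ g₀ '' (S ∩ {p | p.1 ≤ β⁻¹}) ∪ g₁ '' (S ∩ {p | β⁻¹ ≤ p.1}) := by
    rintro _ ⟨p, hp, rfl⟩
    rw [skewMap]
    split_ifs with h
    · exact Or.inl ⟨p, ⟨hp, h⟩, rfl⟩
    · exact Or.inr ⟨p, ⟨hp, (not_le.1 h).le⟩, rfl⟩
  have hcompact : ∀ {t : Set (ℝ × ℝ)}, t ⊆ S → IsCompact (closure t) := fun ht =>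
    hS.of_isClosed_subset isClosed_closure (closure_mono ht)
  refine (closure_mono himage).trans ?_
  rw [closure_union,
    ← image_closure_of_isCompact (hcompact inter_subset_left) (by fun_prop),
    ← image_closure_of_isCompact (hcompact inter_subset_left) (by fun_prop)]
  rintro _ (⟨p, hp, rfl⟩ | ⟨p, hp, rfl⟩)
  · have hp1 : p.1 ≤ β⁻¹ := closure_minimal (inter_subset_right (s := S))
      (isClosed_le continuous_fst continuous_const) hp
    exact Or.inl ⟨p, closure_mono inter_subset_left hp, if_pos hp1⟩
  · have hp1 : β⁻¹ ≤ p.1 := closure_minimal (inter_subset_right (s := S))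
      (isClosed_le continuous_const continuous_fst) hp
    rcases hp1.eq_or_lt with heq | hlt
    · right
      change β * p.1 - 1 = 0
      rw [← heq, mul_inv_cancel₀ hβ.ne', sub_self]
    · exact Or.inl ⟨p, closure_mono inter_subset_left hp, if_neg (not_le.2 hlt)⟩

theorem isCompact_closure_skewMap_iterate (hβ : 1 < β) (hβ2 : β < 2) (hτ0 : 0 < τ)
    (hτ : τ < 1 / 2) (n : ℕ) :
    IsCompact (closure ((skewMap β τ)^[n] '' (Icc 0 1 ×ˢ Icc 0 1))) :=
  (isCompact_Icc.prod isCompact_Icc).closure_of_subset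
    ((skewMap_mapsTo_square hβ hβ2 hτ0 hτ).iterate n).image_subset

theorem closure_skewMap_iterate_subset (hβ : 1 < β) (hβ2 : β < 2) (hτ0 : 0 < τ)
    (hτ : τ < 1 / 2) (n : ℕ) :
    closure ((skewMap β τ)^[n] '' (Icc 0 1 ×ˢ Icc 0 1)) ⊆
      (skewMap β τ)^[n] '' (Icc 0 1 ×ˢ Icc 0 1) ∪ {p | p.1 = 0} := by
  have hβ0 : 0 < β := one_pos.trans hβ
  induction n with
  | zero =>
    rw [Function.iterate_zero, image_id, (isClosed_Icc.prod isClosed_Icc).closure_eq]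
    exact subset_union_left
  | succ n ih =>
    rw [Function.iterate_succ', image_comp]
    refine (closure_skewMap_image_subset hβ0
      (isCompact_closure_skewMap_iterate hβ hβ2 hτ0 hτ n)).trans ?_
    refine union_subset ?_ subset_union_right
    rintro _ ⟨p, hp, rfl⟩
    rcases ih hp with hp | hp
    · exact Or.inl (mem_image_of_mem _ hp)
    · refine Or.inr ?_
      change (skewMap β τ p).1 = 0
      rw [skewMap_fst, betaMap, show p.1 = 0 from hp, if_pos (inv_nonneg.2 hβ0.le), mul_zero]

theorem iInter_closure_subset_attractor_union (hβ : 1 < β) (hβ2 : β < 2) (hτ0 : 0 < τ)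
    (hτ : τ < 1 / 2) :
    ⋂ n : ℕ, closure ((skewMap β τ)^[n] '' (Icc 0 1 ×ˢ Icc 0 1)) ⊆
      attractor β τ ∪ {p | p.1 = 0} := fun p hp => by
  by_cases h0 : p.1 = 0
  · exact Or.inr h0
  · refine Or.inl (subset_closure (mem_iInter.2 fun n => ?_))
    exact (closure_skewMap_iterate_subset hβ hβ2 hτ0 hτ n (mem_iInter.1 hp n)).resolve_right h0

theorem exists_isOpen_superset_ediam_le {X : Type*} [PseudoEMetricSpace X] {t : Set X} {c s : ℝ}
    {ε : ℝ≥0∞} (hs : 0 < s) (ht : ediam t < ENNReal.ofReal c) (hε : 0 < ε) :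
    ∃ r : ℝ, 0 < r ∧ r ≤ c ∧ ENNReal.ofReal (r ^ s) ≤ ediam t ^ s + ε ∧
      ∃ U : Set X, IsOpen U ∧ t ⊆ U ∧ ediam U ≤ ENNReal.ofReal r := by
  obtain ⟨d, hd0, hd⟩ : ∃ d : ℝ, 0 ≤ d ∧ ENNReal.ofReal d = ediam t :=
    ⟨_, ENNReal.toReal_nonneg, ENNReal.ofReal_toReal (ht.trans ENNReal.ofReal_lt_top).ne⟩
  rw [← hd] at ht ⊢
  have htop : ENNReal.ofReal d ^ s ≠ ∞ :=
    ENNReal.rpow_ne_top_of_nonneg hs.le ENNReal.ofReal_ne_top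
  have hdc : d < c := (ENNReal.ofReal_lt_ofReal_iff_of_nonneg hd0).1 ht
  have hcont : Continuous fun r : ℝ => ENNReal.ofReal r ^ s :=
    ENNReal.continuous_rpow_const.comp ENNReal.continuous_ofReal
  have hnear : ∀ᶠ r in 𝓝 d, ENNReal.ofReal r ^ s < ENNReal.ofReal d ^ s + ε :=
    hcont.continuousAt.eventually_lt_const (ENNReal.lt_add_right htop hε.ne')
  obtain ⟨r, ⟨hrε, hrc⟩, hdr⟩ := ((hnear.and (Iio_mem_nhds hdc)).filter_mono
    nhdsWithin_le_nhds |>.and (self_mem_nhdsWithin (s := Ioi d))).exists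
  have hr0 : 0 < r := hd0.trans_lt hdr
  have hδ : 0 < (r - d) / 2 := half_pos (sub_pos.2 hdr)
  refine ⟨r, hr0, le_of_lt hrc, ?_, thickening ((r - d) / 2) t, isOpen_thickening,
    self_subset_thickening hδ t, ?_⟩
  · rw [← ENNReal.ofReal_rpow_of_pos hr0]
    exact hrε.le
  · have hthick := ediam_thickening_le (s := t) ((r - d) / 2).toNNReal
    rw [Real.coe_toNNReal _ hδ.le] at hthick
    refine hthick.trans_eq ?_
    change _ + 2 * ENNReal.ofReal _ = _
    rw [← hd, ← ENNReal.ofReal_ofNat 2, ← ENNReal.ofReal_mul zero_le_two,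
      ← ENNReal.ofReal_add hd0 (by linarith)]
    congr 1
    ring

theorem hausdorffMeasure_iInter_closure_ne_zero (hβ : 1 < β) (hβ2 : β < 2) (hτ0 : 0 < τ)
    (hτ : τ < 1 / 2) {σ : ℝ} (hσ0 : 0 < σ) (hσ : τ ^ σ = β⁻¹) :
    μH[1 + σ] (⋂ n : ℕ, closure ((skewMap β τ)^[n] '' (Icc 0 1 ×ˢ Icc 0 1))) ≠ 0 := by
  intro hzero
  have hc : 0 < 1 - 2 * τ := by linarith
  have hs : 0 < 1 + σ := by linarith
  obtain ⟨K, hK, hvol⟩ := exists_volume_preimage_iterate_le_rpow hβ hβ2 hτ0 hτ hσ0 hσ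
  obtain ⟨δ, hδ0, hδ⟩ := ENNReal.exists_nnreal_pos_mul_lt hK one_ne_zero
  have hδ2 : 0 < (δ : ℝ≥0∞) / 2 := ENNReal.half_pos (ENNReal.coe_pos.2 hδ0).ne'
  have hρ : 0 < ENNReal.ofReal ((1 - 2 * τ) / 2) := ENNReal.ofReal_pos.2 (half_pos hc)
  have hinf := (le_iSup₂ _ hρ).trans_eq ((Measure.hausdorffMeasure_apply _ _).symm.trans hzero)
  obtain ⟨t, ht⟩ := iInf_lt_iff.1 (hinf.trans_lt hδ2)
  obtain ⟨hcov, ht⟩ := iInf_lt_iff.1 ht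
  obtain ⟨hdiam, hsum⟩ := iInf_lt_iff.1 ht
  obtain ⟨ε, hε0, hε⟩ := ENNReal.exists_pos_sum_of_countable' hδ2.ne' ℕ
  choose r hr0 hrc hrs U hUo htU hU using fun i => exists_isOpen_superset_ediam_le hs
    ((hdiam i).trans_lt ((ENNReal.ofReal_lt_ofReal_iff hc).2 (half_lt_self hc))) (hε0 i)
  have hcompact := isCompact_closure_skewMap_iterate hβ hβ2 hτ0 hτ
  have hanti : Antitone fun n : ℕ => (skewMap β τ)^[n] '' (Icc (0 : ℝ) 1 ×ˢ Icc (0 : ℝ) 1) :=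
    antitone_nat_of_succ_le fun n => by
      rw [Function.iterate_succ, image_comp]
      exact image_mono (skewMap_mapsTo_square hβ hβ2 hτ0 hτ).image_subset
  have hopen : IsOpen (⋃ i, U i) := isOpen_iUnion hUo
  obtain ⟨n₀, hn₀⟩ := exists_subset_nhds_of_isCompact
    (Antitone.directed_ge fun m n hmn => closure_mono (hanti hmn)) hcompact
    fun p hp => hopen.mem_nhds (iUnion_mono htU (hcov hp))
  obtain ⟨T, hT⟩ := (hcompact n₀).elim_finite_subcover U hUo hn₀
  choose N hN using fun i => hvol (r i) (hr0 i) (hrc i)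
  set n := max n₀ (T.sup N)
  have hsub : Icc (0 : ℝ) 1 ⊆ ⋃ i ∈ T, {x ∈ Icc (0 : ℝ) 1 | (skewMap β τ)^[n] (x, 0) ∈ U i} :=
    fun x hx => by
      have hmem : (skewMap β τ)^[n] (x, 0) ∈ ⋃ i ∈ T, U i :=
        hT (subset_closure (hanti (le_max_left n₀ (T.sup N))
          (mem_image_of_mem _ ⟨hx, left_mem_Icc.2 zero_le_one⟩)))
      obtain ⟨i, hi, hxi⟩ := mem_iUnion₂.1 hmem
      exact mem_iUnion₂.2 ⟨i, hi, hx, hxi⟩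
  have hnonempty : ∀ i, ediam (t i) ^ (1 + σ) ≤
      ⨆ _ : (t i).Nonempty, ediam (t i) ^ (1 + σ) := fun i => by
    rcases (t i).eq_empty_or_nonempty with h | h
    · simp [h, hs]
    · exact le_iSup_of_le h le_rfl
  refine lt_irrefl (1 : ℝ≥0∞) ?_
  calc (1 : ℝ≥0∞) = volume (Icc (0 : ℝ) 1) := by simp
    _ ≤ ∑ i ∈ T, volume {x ∈ Icc (0 : ℝ) 1 | (skewMap β τ)^[n] (x, 0) ∈ U i} :=
        (measure_mono hsub).trans (measure_biUnion_finset_le T _)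
    _ ≤ ∑ i ∈ T, K * ENNReal.ofReal (r i ^ (1 + σ)) := Finset.sum_le_sum fun i hi =>
        hN i n ((Finset.le_sup hi).trans (le_max_right _ _)) (U i) (hU i)
    _ = K * ∑ i ∈ T, ENNReal.ofReal (r i ^ (1 + σ)) := Finset.mul_sum _ _ _ |>.symm
    _ ≤ K * ∑' i, ((⨆ _ : (t i).Nonempty, ediam (t i) ^ (1 + σ)) + ε i) := by
        gcongr
        refine (Finset.sum_le_sum fun i _ => ?_).trans (ENNReal.sum_le_tsum T)
        exact (hrs i).trans (add_le_add_left (hnonempty i) _)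
    _ ≤ K * (δ / 2 + δ / 2) := by
        rw [ENNReal.tsum_add]
        gcongr
    _ < 1 := by rwa [ENNReal.add_halves, mul_comm]

theorem dimH_setOf_fst_eq_zero_le : dimH {p : ℝ × ℝ | p.1 = 0} ≤ 1 := by
  have hrange : {p : ℝ × ℝ | p.1 = 0} = range fun y : ℝ => ((0 : ℝ), y) := by
    ext ⟨x, y⟩
    simp [eq_comm]
  rw [hrange, ← Real.dimH_univ]
  exact (LipschitzWith.prodMk_left (0 : ℝ)).dimH_range_le

theorem le_dimH_attractor (hβ : 1 < β) (hβ2 : β < 2) (hτ0 : 0 < τ) (hτ : τ < 1 / 2) {σ : ℝ}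
    (hσ0 : 0 < σ) (hσ : τ ^ σ = β⁻¹) : ENNReal.ofReal (1 + σ) ≤ dimH (attractor β τ) := by
  have hs : 0 ≤ 1 + σ := by linarith
  have hle : ENNReal.ofReal (1 + σ) ≤ dimH (attractor β τ ∪ {p | p.1 = 0}) :=
    (le_dimH_of_hausdorffMeasure_ne_zero (d := (1 + σ).toNNReal) <| by
      rw [Real.coe_toNNReal _ hs]
      exact hausdorffMeasure_iInter_closure_ne_zero hβ hβ2 hτ0 hτ hσ0 hσ).trans
      (dimH_mono (iInter_closure_subset_attractor_union hβ hβ2 hτ0 hτ))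
  rw [dimH_union, le_max_iff] at hle
  refine hle.resolve_right fun h => ?_
  have := h.trans dimH_setOf_fst_eq_zero_le
  rw [ENNReal.ofReal_le_one] at this
  linarith

end LowerBound

/-- The Hausdorff dimension of the attractor equals `1 + log β / log (τ⁻¹)`, which
lies strictly between `1` and `2`. -/
theorem stmt17 (β τ : ℝ) (hβ : 1 < β) (hβ2 : β < 2) (hτ0 : 0 < τ) (hτ : τ < 1 / 2) :
    dimH (attractor β τ) = ENNReal.ofReal (1 + Real.log β / Real.log τ⁻¹) ∧
    1 < 1 + Real.log β / Real.log τ⁻¹ ∧ 1 + Real.log β / Real.log τ⁻¹ < 2 := by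
  have hβ0 : 0 < β := one_pos.trans hβ
  have hβτ : β < τ⁻¹ := hβ2.trans (by rw [lt_inv_comm₀ two_pos hτ0]; linarith)
  have hlogτ : 0 < Real.log τ⁻¹ := Real.log_pos (hβ.trans hβτ)
  have hσ0 : 0 < Real.log β / Real.log τ⁻¹ := div_pos (Real.log_pos hβ) hlogτ
  have hσ1 : Real.log β / Real.log τ⁻¹ < 1 := (div_lt_one hlogτ).2 (Real.log_lt_log hβ0 hβτ)
  have hσ : τ ^ (Real.log β / Real.log τ⁻¹) = β⁻¹ := by
    rw [Real.log_inv] at hlogτ ⊢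
    rw [Real.rpow_def_of_pos hτ0, div_neg, mul_neg, mul_div_cancel₀ _ (neg_pos.1 hlogτ).ne,
      Real.exp_neg, Real.exp_log hβ0]
  refine ⟨le_antisymm ?_ (le_dimH_attractor hβ hβ2 hτ0 hτ hσ0 hσ), by linarith, by linarith⟩
  have hs : 0 ≤ 1 + Real.log β / Real.log τ⁻¹ := by linarith
  refine dimH_le_of_hausdorffMeasure_ne_top (d := Real.toNNReal _) ?_
  rw [Real.coe_toNNReal _ hs]
  refine ((hausdorffMeasure_attractor_le hβ hτ0 hτ hs ?_).trans_lt ENNReal.ofNat_lt_top).ne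
  rw [Real.rpow_add hτ0, Real.rpow_one, hσ, div_eq_mul_inv]
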